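/- There do not exist vectors e₁, e₂, e₃ ∈ ℝ⁴ and ẽ₁, ẽ₂, ẽ₃ ∈ ℝ⁴ and signs σ, τ ∈ {1, −1} such that the 3×3 matrix (ẽ_b^i)_{i,b∈{1,2,3}} is invertible and for all a ∈ {1,2,3} and all I,J ∈ {0,1,2,3}: σ Σ_{b,c∈{1,2,3}} ε_{abc} e_b^I e_c^J = (τ/2) Σ_{b,c∈{1,2,3}} Σ_{K,L∈{0,1,2,3}} ε_{abc} ε_{IJKL} ẽ_b^K ẽ_c^L. -/

import Mathlib

open scoped BigOperators

/-- Levi-Civita symbol on indices `{1,2,3}` (here `Fin 3`), with `ε_{123} = 1`. -/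
noncomputable def eps3 (a b c : Fin 3) : ℝ :=
  Matrix.det (Matrix.of fun i j => if (![a, b, c]) i = j then (1 : ℝ) else 0)

/-- Levi-Civita symbol on indices `{0,1,2,3}` (here `Fin 4`), with `ε_{0123} = 1`. -/
noncomputable def eps4 (a b c d : Fin 4) : ℝ :=
  Matrix.det (Matrix.of fun i j => if (![a, b, c, d]) i = j then (1 : ℝ) else 0)


theorem eps3_eq (a b c : Fin 3) :
    eps3 a b c = ((b : ℝ) - a) * ((c : ℝ) - a) * ((c : ℝ) - b) / 2 := by
  fin_cases a <;> fin_cases b <;> fin_cases c <;>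
    simp [eps3, Matrix.det_fin_three] <;> norm_num

theorem eps4_zero_succ_succ_succ (a b c : Fin 3) :
    eps4 0 a.succ b.succ c.succ = eps3 a b c := by
  rw [eps4, Matrix.det_succ_row_zero, Finset.sum_eq_single 0]
  · simp only [Matrix.of_apply, Matrix.cons_val_zero, Fin.val_zero, pow_zero, if_true, one_mul,
      eps3]
    congr 1
    ext i j
    fin_cases i <;> simp <;> rfl
  · intro j _ hj
    simp [hj.symm]
  · simp

theorem eps4_zero_zero_right (a d : Fin 4) : eps4 0 a 0 d = 0 :=
  Matrix.det_zero_of_row_eq (i := 0) (j := 2) (by decide) (by ext j; rfl)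

theorem eps4_zero_right (a b : Fin 4) : eps4 0 a b 0 = 0 :=
  Matrix.det_zero_of_row_eq (i := 0) (j := 3) (by decide) (by ext j; rfl)

/-- The electric components `I = 0` of the dual of a bivector only involve spatial components. -/
theorem sum_eps4_zero_succ (x y : Fin 4 → ℝ) (i : Fin 3) :
    ∑ K : Fin 4, ∑ L : Fin 4, eps4 0 i.succ K L * x K * y L
      = ∑ k : Fin 3, ∑ l : Fin 3, eps3 i k l * x k.succ * y l.succ := by
  simp [Fin.sum_univ_succ (n := 3), eps4_zero_succ_succ_succ, eps4_zero_zero_right,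
    eps4_zero_right]

/-- The matrix `ε_{abc} p_b q_c^i` is a product with a singular antisymmetric matrix. -/
theorem det_sum_eps3_mul (p : Fin 3 → ℝ) (q : Fin 3 → Fin 3 → ℝ) :
    (Matrix.of fun a i : Fin 3 => ∑ b : Fin 3, ∑ c : Fin 3, eps3 a b c * p b * q c i).det = 0 := by
  simp only [Matrix.det_fin_three, Matrix.of_apply, Fin.sum_univ_three, eps3_eq]
  norm_num
  ring

/-- Twice the cofactor matrix of a `3 × 3` matrix has determinant `8 det²`. -/
theorem det_sum_eps3_mul_eps3 (u : Fin 3 → Fin 3 → ℝ) :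
    (Matrix.of fun a i : Fin 3 => ∑ b : Fin 3, ∑ c : Fin 3,
      eps3 a b c * ∑ k : Fin 3, ∑ l : Fin 3, eps3 i k l * u b k * u c l).det
      = 8 * (Matrix.of fun i b : Fin 3 => u b i).det ^ 2 := by
  simp only [Matrix.det_fin_three, Matrix.of_apply, Fin.sum_univ_three, eps3_eq]
  norm_num
  ring

/-- Disjointness of the solution sectors of the simplicity constraint: a
momentum field of the 'topological' form `σ ε_{abc} e_b^I e_c^J` (σ = ±1) can never coincide
with one of the 'gravitational' form `(τ/2) ε_{abc} ε_{IJKL} ẽ_b^K ẽ_c^L` (τ = ±1) having an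
invertible spatial triad matrix `(ẽ_b^i)`. -/
theorem simplicity_sectors_disjoint :
    ¬ ∃ (e et : Fin 3 → Fin 4 → ℝ) (σ τ : ℝ),
      (σ = 1 ∨ σ = -1) ∧ (τ = 1 ∨ τ = -1) ∧
      IsUnit (Matrix.of fun i b : Fin 3 => et b i.succ).det ∧
      ∀ (a : Fin 3) (I J : Fin 4),
        σ * ∑ b : Fin 3, ∑ c : Fin 3, eps3 a b c * e b I * e c J
          = (τ / 2) * ∑ b : Fin 3, ∑ c : Fin 3, ∑ K : Fin 4, ∑ L : Fin 4,
              eps3 a b c * eps4 I J K L * et b K * et c L := by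
  rintro ⟨e, et, σ, τ, -, hτ, hdet, h⟩
  have hτ0 : τ / 2 ≠ 0 := by rcases hτ with rfl | rfl <;> norm_num
  have hmat : σ • (Matrix.of fun a i : Fin 3 =>
        ∑ b : Fin 3, ∑ c : Fin 3, eps3 a b c * e b 0 * e c i.succ)
      = (τ / 2) • (Matrix.of fun a i : Fin 3 => ∑ b : Fin 3, ∑ c : Fin 3,
        eps3 a b c * ∑ k : Fin 3, ∑ l : Fin 3, eps3 i k l * et b k.succ * et c l.succ) := by
    ext a i
    simp only [Matrix.smul_apply, Matrix.of_apply, smul_eq_mul, ← sum_eps4_zero_succ]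
    rw [h a 0 i.succ]
    simp only [Finset.mul_sum, mul_assoc]
  have hd := congrArg Matrix.det hmat
  rw [Matrix.det_smul, Matrix.det_smul, det_sum_eps3_mul (fun b => e b 0) fun c i => e c i.succ,
    det_sum_eps3_mul_eps3 fun b k => et b k.succ, mul_zero] at hd
  exact mul_ne_zero (pow_ne_zero _ hτ0)
    (mul_ne_zero (by norm_num) (pow_ne_zero 2 hdet.ne_zero)) hd.symm
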